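/- arXiv:2104.10146 — 4 statements merged into one kernel-verified Lean document; each statement's English description precedes it below -/
import Mathlib

section
/- Let K be a field, R = K[x₁,…,xₙ], m = ⟨x₁,…,xₙ⟩, and M ⊊ R^k a proper submodule such that the only associated prime of R^k/M is m. Then there exists r ∈ ℕ with m^{r+1}·R^k ⊆ M. Moreover, if K has characteristic zero and r ∈ ℕ satisfies m^{r+1}·R^k ⊆ M, then every polynomial solution q of M is a vector of polynomials of total degree at most r. -/
open MvPolynomial

/-- Iterated formal partial derivative `∂^α q` of a polynomial `q`. -/
noncomputable def ipdP {K : Type} [CommSemiring K] {n : ℕ} (α : Fin n → ℕ)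
    (q : MvPolynomial (Fin n) K) : MvPolynomial (Fin n) K :=
  ((List.ofFn fun i : Fin n => (fun g => (MvPolynomial.pderiv i) g)^[α i]).foldr (· ∘ ·) id) q

/-- The operator `p(∂)` acting formally on a polynomial `q`:
`p(∂)•q = ∑_α c_α ∂^α q` where `p = ∑_α c_α x^α`. -/
noncomputable def PDopP {K : Type} [CommSemiring K] {n : ℕ}
    (p q : MvPolynomial (Fin n) K) : MvPolynomial (Fin n) K :=
  ∑ α ∈ p.support, (p.coeff α) • ipdP (fun i => α i) q

/-- If `m` is the only associated prime of a finite module over a Noetherian ring, then a power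
of `m` annihilates the module. -/
theorem exists_pow_le_annihilator_of_associatedPrimes_eq_singleton {R N : Type*} [CommRing R]
    [IsNoetherianRing R] [AddCommGroup N] [Module R N] [Module.Finite R N] {m : Ideal R}
    (h : associatedPrimes R N = {m}) : ∃ r : ℕ, m ^ r ≤ Module.annihilator R N := by
  refine Ideal.exists_pow_le_of_le_radical_of_fg_radical ?_ (IsNoetherian.noetherian _)
  rw [← Ideal.sInf_minimalPrimes]
  refine le_sInf fun p hp => ?_
  have hp' := Module.associatedPrimes.minimalPrimes_annihilator_subset_associatedPrimes R N hp
  rw [h] at hp'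
  exact hp'.ge

theorem coeff_iterate_pderiv {R σ : Type*} [CommSemiring R] (i : σ) (a : ℕ)
    (p : MvPolynomial σ R) (m : σ →₀ ℕ) :
    coeff m ((fun g => pderiv i g)^[a] p) =
      coeff (m + Finsupp.single i a) p * ((m i + 1).ascFactorial a : ℕ) := by
  induction a generalizing p with
  | zero => simp
  | succ a ih =>
    rw [Function.iterate_succ_apply, ih, coeff_pderiv, add_assoc, ← Finsupp.single_add,
      Nat.ascFactorial_succ]
    simp only [Finsupp.add_apply, Finsupp.single_eq_same]
    push_cast
    ring

theorem exists_coeff_foldr_iterate_pderiv {R σ : Type*} [CommSemiring R] (α : σ → ℕ)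
    (l : List σ) (p : MvPolynomial σ R) (m : σ →₀ ℕ) :
    ∃ c : ℕ, c ≠ 0 ∧
      coeff m ((l.map fun i => (fun g => pderiv i g)^[α i]).foldr (· ∘ ·) id p) =
        coeff (m + (l.map fun i => Finsupp.single i (α i)).sum) p * (c : R) := by
  induction l generalizing m with
  | nil => exact ⟨1, one_ne_zero, by simp⟩
  | cons i l ih =>
    obtain ⟨c, hc, h⟩ := ih (m + Finsupp.single i (α i))
    refine ⟨c * (m i + 1).ascFactorial (α i),
      mul_ne_zero hc (Nat.ascFactorial_pos _ _).ne', ?_⟩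
    rw [List.map_cons, List.foldr_cons, Function.comp_apply, coeff_iterate_pderiv, h,
      List.map_cons, List.sum_cons, add_assoc, Nat.cast_mul, mul_assoc]

/-- The constant coefficient of `∂^α q` is a nonzero multiple of the coefficient of `x^α`. -/
theorem exists_coeff_zero_ipdP {K : Type} [CommSemiring K] {n : ℕ} (d : Fin n →₀ ℕ)
    (q : MvPolynomial (Fin n) K) :
    ∃ c : ℕ, c ≠ 0 ∧ coeff 0 (ipdP (fun i => d i) q) = coeff d q * (c : K) := by
  obtain ⟨c, hc, h⟩ := exists_coeff_foldr_iterate_pderiv d (List.finRange n) q 0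
  refine ⟨c, hc, ?_⟩
  rw [ipdP, List.ofFn_eq_map, h, ← List.ofFn_eq_map, List.sum_ofFn, Finsupp.univ_sum_single,
    zero_add]

theorem PDopP_zero {K : Type} [CommSemiring K] {n : ℕ} (q : MvPolynomial (Fin n) K) :
    PDopP 0 q = 0 := by
  simp [PDopP]

theorem PDopP_monomial_one {K : Type} [CommSemiring K] [Nontrivial K] {n : ℕ} (d : Fin n →₀ ℕ)
    (q : MvPolynomial (Fin n) K) : PDopP (monomial d 1) q = ipdP (fun i => d i) q := by
  classical
  simp [PDopP, support_monomial]

/-- if `M ⊊ R^k` is proper with only associated prime `m = ⟨x₁,…,xₙ⟩`, then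
`m^{r+1}·R^k ⊆ M` for some `r`; moreover in characteristic zero, whenever
`m^{r+1}·R^k ⊆ M`, every polynomial solution of `M` has total degree at most `r`
in each coordinate. -/
theorem stmt6 {K : Type} [Field K] {n k : ℕ}
    (M : Submodule (MvPolynomial (Fin n) K) (Fin k → MvPolynomial (Fin n) K))
    (hM : M ≠ ⊤)
    (hass : associatedPrimes (MvPolynomial (Fin n) K)
        ((Fin k → MvPolynomial (Fin n) K) ⧸ M)
      = {Ideal.span (Set.range (X : Fin n → MvPolynomial (Fin n) K))}) :
    (∃ r : ℕ,
      (Ideal.span (Set.range (X : Fin n → MvPolynomial (Fin n) K))) ^ (r + 1) •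
        (⊤ : Submodule (MvPolynomial (Fin n) K) (Fin k → MvPolynomial (Fin n) K)) ≤ M) ∧
    (CharZero K → ∀ r : ℕ,
      (Ideal.span (Set.range (X : Fin n → MvPolynomial (Fin n) K))) ^ (r + 1) •
        (⊤ : Submodule (MvPolynomial (Fin n) K) (Fin k → MvPolynomial (Fin n) K)) ≤ M →
      ∀ q : Fin k → MvPolynomial (Fin n) K,
        (∀ m ∈ M, (∑ j, PDopP (m j) (q j)) = 0) →
        ∀ j, (q j).totalDegree ≤ r) := by
  constructor
  · obtain ⟨r, hr⟩ := exists_pow_le_annihilator_of_associatedPrimes_eq_singleton hass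
    refine ⟨r, Submodule.smul_le.2 fun a ha v _ => ?_⟩
    have hav := Module.mem_annihilator.1 (hr (Ideal.pow_le_pow_right r.le_succ ha))
      (Submodule.Quotient.mk v)
    rwa [← Submodule.Quotient.mk_smul, Submodule.Quotient.mk_eq_zero] at hav
  · intro _ r hr q hq j
    refine Finset.sup_le fun d hd => ?_
    by_contra! hdeg
    have hmem : Pi.single j (monomial d 1) ∈ M := by
      have hpow : monomial d (1 : K) ∈ idealOfVars (Fin n) K ^ (r + 1) :=
        (monomial_mem_pow_idealOfVars_iff (r + 1) d one_ne_zero).2 hdeg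
      simpa [← Pi.single_smul] using
        hr (Submodule.smul_mem_smul hpow (Submodule.mem_top (x := Pi.single j 1)))
    have hsum := hq _ hmem
    rw [Finset.sum_eq_single j (fun i _ hij => by rw [Pi.single_eq_of_ne hij, PDopP_zero])
      (by simp), Pi.single_eq_same, PDopP_monomial_one] at hsum
    obtain ⟨c, hc, h⟩ := exists_coeff_zero_ipdP d (q j)
    rw [hsum, coeff_zero] at h
    exact mul_ne_zero (mem_support_iff.1 hd) (Nat.cast_ne_zero.2 hc) h.symm
end

section
/- Let M ⊆ R^k be a submodule over R = ℂ[x₁,…,xₙ], let u ∈ ℂⁿ, and let γ_u : R → R be the ℂ-algebra automorphism determined by x_i ↦ x_i + u_i, applied coordinatewise to R^k. Then for any vector B ∈ ℂ[x₁,…,xₙ]^k of polynomials, the function z ↦ B(z)·exp(u₁z₁+⋯+uₙzₙ) lies in Sol(M) if and only if B is a polynomial solution of the submodule γ_u(M), i.e. ∑_{j=1}^k (γ_u(m))_j(∂)•B_j = 0 for all m ∈ M. -/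
open MvPolynomial

/-- Partial derivative of a function `ℝⁿ → ℂ` in the `i`-th coordinate direction. -/
noncomputable def pdF {n : ℕ} (i : Fin n) (f : (Fin n → ℝ) → ℂ) : (Fin n → ℝ) → ℂ :=
  fun z => fderiv ℝ f z (Pi.single i 1)

/-- Iterated partial derivative `∂^α f` for a multi-index `α`. -/
noncomputable def ipdF {n : ℕ} (α : Fin n → ℕ) (f : (Fin n → ℝ) → ℂ) : (Fin n → ℝ) → ℂ :=
  ((List.ofFn fun i : Fin n => (pdF i)^[α i]).foldr (· ∘ ·) id) f

/-- The constant-coefficient differential operator `p(∂)` applied to a function: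
`p(∂)•f = ∑_α c_α ∂^α f` where `p = ∑_α c_α x^α`. -/
noncomputable def PDop {n : ℕ} (p : MvPolynomial (Fin n) ℂ) (f : (Fin n → ℝ) → ℂ) :
    (Fin n → ℝ) → ℂ :=
  ∑ α ∈ p.support, (p.coeff α) • ipdF (fun i => α i) f

/-- The solution space `Sol(M)` of a submodule `M ⊆ R^k`: the smooth functions
`ψ : ℝⁿ → ℂ^k` with `∑_j m_j(∂)•ψ_j = 0` for all `m ∈ M`. -/
def SolM {n k : ℕ} (M : Submodule (MvPolynomial (Fin n) ℂ) (Fin k → MvPolynomial (Fin n) ℂ)) :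
    Set (Fin k → (Fin n → ℝ) → ℂ) :=
  {ψ | (∀ j, ContDiff ℝ (⊤ : ℕ∞) (ψ j)) ∧ ∀ m ∈ M, (∑ j, PDop (m j) (ψ j)) = 0}

theorem foldr_comp_semiconj {ι A B : Type*} (e : A → B) (g : ι → A → A) (h : ι → B → B)
    (l : List ι) (hgh : ∀ i, Function.Semiconj e (g i) (h i)) :
    Function.Semiconj e ((l.map g).foldr (· ∘ ·) id) ((l.map h).foldr (· ∘ ·) id) := by
  induction l with
  | nil => exact Function.Semiconj.id_right
  | cons i l ih => exact (hgh i).comp_right ih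

theorem coe_list_prod_end {ι K V : Type*} [CommSemiring K] [AddCommMonoid V] [Module K V]
    (g : ι → Module.End K V) (l : List ι) :
    ⇑(l.map g).prod = (l.map fun i => ⇑(g i)).foldr (· ∘ ·) id := by
  induction l with
  | nil => rfl
  | cons i l ih => simp [ih, Module.End.mul_eq_comp, LinearMap.coe_comp]

theorem map_aeval_eq_sum_list_prod {K S A : Type*} [CommSemiring K] [CommSemiring S] [Semiring A]
    [Algebra K S] [Algebra K A] {n : ℕ} (φ : S →ₐ[K] A) (t : Fin n → S)
    (p : MvPolynomial (Fin n) K) :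
    φ (aeval t p) =
      ∑ α ∈ p.support, p.coeff α • ((List.finRange n).map fun i => φ (t i) ^ α i).prod := by
  rw [aeval_def, eval₂_eq', map_sum]
  refine Finset.sum_congr rfl fun α _ => ?_
  rw [← Algebra.smul_def, map_smul, ← List.prod_ofFn, map_list_prod, List.map_ofFn,
    List.ofFn_eq_map]
  simp [Function.comp_def]

theorem pderiv_pderiv_comm {K σ : Type*} [CommSemiring K] (i j : σ) (q : MvPolynomial σ K) :
    pderiv i (pderiv j q) = pderiv j (pderiv i q) := by
  classical
  induction q using MvPolynomial.induction_on with
  | C a => simp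
  | add p q hp hq => simp [hp, hq]
  | mul_X p k hp =>
    simp only [pderiv_mul, map_add, pderiv_X, hp]
    by_cases hi : i = k <;> by_cases hj : j = k <;> simp [hi, hj]

open scoped IsMulCommutative in
theorem exists_algHom_X_eq_pderiv (K σ : Type*) [CommSemiring K] :
    ∃ φ : MvPolynomial σ K →ₐ[K] Module.End K (MvPolynomial σ K),
      ∀ i, φ (X i) = (pderiv i).toLinearMap := by
  let D : σ → Module.End K (MvPolynomial σ K) := fun i => (pderiv i).toLinearMap
  have hcomm : ∀ a ∈ Set.range D, ∀ b ∈ Set.range D, a * b = b * a := by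
    rintro _ ⟨i, rfl⟩ _ ⟨j, rfl⟩
    exact LinearMap.ext fun q => pderiv_pderiv_comm i j q
  have := Algebra.isMulCommutative_adjoin K hcomm
  let ψ : MvPolynomial σ K →ₐ[K] Algebra.adjoin K (Set.range D) :=
    aeval fun i => ⟨D i, Algebra.subset_adjoin ⟨i, rfl⟩⟩
  refine ⟨(Algebra.adjoin K (Set.range D)).val.comp ψ, fun i => ?_⟩
  simp [ψ, D]

theorem PDopP_eq_algHom {K : Type} [CommSemiring K] {n : ℕ}
    {φ : MvPolynomial (Fin n) K →ₐ[K] Module.End K (MvPolynomial (Fin n) K)}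
    (hφ : ∀ i, φ (X i) = (pderiv i).toLinearMap) (p q : MvPolynomial (Fin n) K) :
    PDopP p q = φ p q := by
  conv_rhs => rw [← aeval_X_left_apply p, map_aeval_eq_sum_list_prod]
  simp only [PDopP, ipdP, LinearMap.sum_apply, LinearMap.smul_apply, coe_list_prod_end,
    List.ofFn_eq_map, hφ, Module.End.coe_pow]
  rfl

theorem contDiff_eval_ofReal {n : ℕ} (q : MvPolynomial (Fin n) ℂ) :
    ContDiff ℝ (⊤ : ℕ∞) fun z : Fin n → ℝ => eval (fun i => (z i : ℂ)) q := by
  induction q using MvPolynomial.induction_on with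
  | C a => simpa using contDiff_const
  | add p q hp hq => simpa using hp.add hq
  | mul_X p k hp =>
    simpa using hp.mul (Complex.ofRealCLM.contDiff.comp (contDiff_apply ℝ ℝ k))

theorem contDiff_exp_linear {n : ℕ} (u : Fin n → ℂ) :
    ContDiff ℝ (⊤ : ℕ∞) fun z : Fin n → ℝ => Complex.exp (∑ i, u i * (z i : ℂ)) :=
  (ContDiff.sum fun i _ =>
    contDiff_const.mul (Complex.ofRealCLM.contDiff.comp (contDiff_apply ℝ ℝ i))).cexp

theorem pdF_mul {n : ℕ} (i : Fin n) {f g : (Fin n → ℝ) → ℂ}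
    (hf : Differentiable ℝ f) (hg : Differentiable ℝ g) :
    pdF i (fun z => f z * g z) = fun z => pdF i f z * g z + f z * pdF i g z := by
  funext z
  simp only [pdF]
  rw [fderiv_fun_mul (hf z) (hg z)]
  simp [mul_comm, add_comm]

theorem hasFDerivAt_ofReal_apply {n : ℕ} (k : Fin n) (z : Fin n → ℝ) :
    HasFDerivAt (fun z : Fin n → ℝ => (z k : ℂ))
      (Complex.ofRealCLM.comp (ContinuousLinearMap.proj (R := ℝ) (φ := fun _ => ℝ) k)) z :=
  Complex.ofRealCLM.hasFDerivAt.comp z (hasFDerivAt_apply k z)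

theorem pdF_ofReal_apply {n : ℕ} (i k : Fin n) (z : Fin n → ℝ) :
    pdF i (fun z => (z k : ℂ)) z = Pi.single (M := fun _ => ℂ) i 1 k := by
  rw [pdF, (hasFDerivAt_ofReal_apply k z).fderiv]
  by_cases hk : k = i <;> simp [hk]

theorem pdF_eval_ofReal {n : ℕ} (i : Fin n) (q : MvPolynomial (Fin n) ℂ) :
    pdF i (fun z => eval (fun i => (z i : ℂ)) q) =
      fun z => eval (fun i => (z i : ℂ)) (pderiv i q) := by
  have hd (q : MvPolynomial (Fin n) ℂ) := (contDiff_eval_ofReal q).differentiable (by simp)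
  induction q using MvPolynomial.induction_on with
  | C a => funext z; simp [pdF]
  | add p q hp hq =>
    funext z
    have hp := congrFun hp z
    have hq := congrFun hq z
    simp only [pdF] at hp hq ⊢
    simp only [map_add]
    rw [fderiv_fun_add (hd p z) (hd q z), add_apply, hp, hq]
  | mul_X p k hp =>
    have hX := hd (X k)
    simp only [eval_X] at hX
    simp only [map_mul, eval_X]
    rw [pdF_mul i (hd p) hX, hp]
    funext z
    by_cases hk : k = i <;> simp [pdF_ofReal_apply, pderiv_X, hk] <;> ring

theorem pdF_exp_linear {n : ℕ} (i : Fin n) (u : Fin n → ℂ) (z : Fin n → ℝ) :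
    pdF i (fun z => Complex.exp (∑ i, u i * (z i : ℂ))) z =
      u i * Complex.exp (∑ i, u i * (z i : ℂ)) := by
  have h : HasFDerivAt (fun z : Fin n → ℝ => ∑ i, u i * (z i : ℂ))
      (∑ i, u i • Complex.ofRealCLM.comp
        (ContinuousLinearMap.proj (R := ℝ) (φ := fun _ => ℝ) i)) z :=
    HasFDerivAt.fun_sum fun i _ => (hasFDerivAt_ofReal_apply i z).const_mul (u i)
  rw [pdF, h.cexp.fderiv]
  simp [Pi.single_apply, apply_ite, mul_comm]

theorem pdF_eval_mul_exp {n : ℕ} (i : Fin n) (u : Fin n → ℂ) (q : MvPolynomial (Fin n) ℂ) :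
    pdF i (fun z => eval (fun i => (z i : ℂ)) q * Complex.exp (∑ i, u i * (z i : ℂ))) =
      fun z => eval (fun i => (z i : ℂ)) (pderiv i q + C (u i) * q) *
        Complex.exp (∑ i, u i * (z i : ℂ)) := by
  rw [pdF_mul i ((contDiff_eval_ofReal q).differentiable (by simp))
    ((contDiff_exp_linear u).differentiable (by simp)), pdF_eval_ofReal]
  funext z
  rw [pdF_exp_linear]
  simp only [map_add, map_mul, eval_C]
  ring

/-- Conjugating `p(∂)` by `exp(uᵀz)` gives the operator of the translate `γ_u(p)`. -/
theorem PDop_eval_mul_exp {n : ℕ} (u : Fin n → ℂ) (p q : MvPolynomial (Fin n) ℂ) :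
    PDop p (fun z => eval (fun i => (z i : ℂ)) q * Complex.exp (∑ i, u i * (z i : ℂ))) =
      fun z => eval (fun i => (z i : ℂ)) (PDopP (aeval (fun i => X i + C (u i)) p) q) *
        Complex.exp (∑ i, u i * (z i : ℂ)) := by
  obtain ⟨φ, hφ⟩ := exists_algHom_X_eq_pderiv ℂ (Fin n)
  let e : MvPolynomial (Fin n) ℂ → (Fin n → ℝ) → ℂ := fun q z =>
    eval (fun i => (z i : ℂ)) q * Complex.exp (∑ i, u i * (z i : ℂ))
  have he (i : Fin n) : Function.Semiconj e (φ (X i + C (u i))) (pdF i) := fun q => by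
    have h : φ (X i + C (u i)) q = pderiv i q + C (u i) * q := by
      rw [← algebraMap_eq, map_add, AlgHom.commutes, hφ]
      simp [C_mul', Module.algebraMap_end_apply, algebraMap_eq]
    rw [h]
    exact (pdF_eval_mul_exp i u q).symm
  have hα (α : Fin n → ℕ) : ipdF α (e q) =
      e (((List.finRange n).map fun i => φ (X i + C (u i)) ^ α i).prod q) := by
    rw [coe_list_prod_end, ipdF, List.ofFn_eq_map]
    refine (foldr_comp_semiconj e _ _ _ (fun i => ?_) q).symm
    rw [Module.End.coe_pow]
    exact (he i).iterate_right (α i)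
  change PDop p (e q) = e _
  rw [PDopP_eq_algHom hφ, map_aeval_eq_sum_list_prod, PDop]
  simp only [hα]
  funext z
  simp [e, Finset.sum_mul, LinearMap.sum_apply, mul_assoc, smul_eval]

theorem eq_zero_of_eval_ofReal_eq_zero {n : ℕ} {q : MvPolynomial (Fin n) ℂ}
    (h : ∀ z : Fin n → ℝ, eval (fun i => (z i : ℂ)) q = 0) : q = 0 := by
  refine funext_set (fun _ => Set.range ((↑) : ℝ → ℂ))
    (fun _ => Set.infinite_range_of_injective Complex.ofReal_injective) fun x hx => ?_
  choose z hz using fun i => hx i (Set.mem_univ i)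
  obtain rfl : (fun i => (z i : ℂ)) = x := _root_.funext hz
  simpa using h z

/-- `z ↦ B(z)·exp(uᵀz)` lies in `Sol(M)` iff `B` is a polynomial solution
of the translated module `γ_u(M)`, where `γ_u : x_i ↦ x_i + u_i`. -/
theorem stmt8 {n k : ℕ}
    (M : Submodule (MvPolynomial (Fin n) ℂ) (Fin k → MvPolynomial (Fin n) ℂ))
    (u : Fin n → ℂ) (B : Fin k → MvPolynomial (Fin n) ℂ) :
    ((fun j => fun z : Fin n → ℝ =>
        MvPolynomial.eval (fun i => (z i : ℂ)) (B j) * Complex.exp (∑ i, u i * (z i : ℂ)))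
      ∈ SolM M)
    ↔ (∀ m ∈ M,
        (∑ j, PDopP (MvPolynomial.aeval
          (fun i => (X i + C (u i) : MvPolynomial (Fin n) ℂ)) (m j)) (B j)) = 0) := by
  constructor
  · rintro ⟨-, h⟩ m hm
    refine eq_zero_of_eval_ofReal_eq_zero fun z => ?_
    have hz := congrFun (h m hm) z
    simp only [PDop_eval_mul_exp, Finset.sum_apply, ← Finset.sum_mul, ← map_sum] at hz
    exact (mul_eq_zero.mp hz).resolve_right (Complex.exp_ne_zero _)
  · intro h
    refine ⟨fun j => (contDiff_eval_ofReal (B j)).mul (contDiff_exp_linear u), fun m hm => ?_⟩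
    funext z
    simp only [PDop_eval_mul_exp, Finset.sum_apply, ← Finset.sum_mul, ← map_sum, h m hm]
    simp
end

section
/- Let p and q be polynomials in n variables with complex coefficients. Then, as smooth functions of (x,z) ∈ ℝⁿ × ℝⁿ, one has q(∂_z)•( p(z)·exp(x₁z₁+⋯+xₙzₙ) ) = p(∂_x)•( q(x)·exp(x₁z₁+⋯+xₙzₙ) ), where ∂_z (respectively ∂_x) denotes partial differentiation with respect to the z-variables (respectively the x-variables). -/
open MvPolynomial

/-- The operator `∂ᵢ + aᵢ` on polynomials, i.e. `∂ᵢ` conjugated by `exp (a ⬝ w)`. -/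
noncomputable def shiftedPderiv {n : ℕ} (a : Fin n → ℂ) (i : Fin n) :
    Module.End ℂ (MvPolynomial (Fin n) ℂ) :=
  (pderiv i).toLinearMap + a i • LinearMap.id

theorem shiftedPderiv_apply {n : ℕ} (a : Fin n → ℂ) (i : Fin n) (P : MvPolynomial (Fin n) ℂ) :
    shiftedPderiv a i P = pderiv i P + a i • P := rfl

theorem pderiv_comm {n : ℕ} (i j : Fin n) (P : MvPolynomial (Fin n) ℂ) :
    pderiv i (pderiv j P) = pderiv j (pderiv i P) := by
  have h : ⁅pderiv (R := ℂ) i, pderiv (R := ℂ) j⁆ = 0 := by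
    apply MvPolynomial.derivation_ext
    intro k
    simp [Derivation.commutator_apply, pderiv_X, Pi.single_apply, apply_ite]
  have := congrArg (fun d : Derivation ℂ _ _ => d P) h
  simpa [Derivation.commutator_apply, sub_eq_zero] using this

theorem shiftedPderiv_commute {n : ℕ} (a : Fin n → ℂ) (i j : Fin n) :
    shiftedPderiv a i * shiftedPderiv a j = shiftedPderiv a j * shiftedPderiv a i := by
  apply LinearMap.ext
  intro P
  simp only [Module.End.mul_apply, shiftedPderiv_apply, map_add, Derivation.map_smul,
    pderiv_comm i j P, smul_comm (a i) (a j) P]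
  abel

/-- The operator `q(∂ + a)` on polynomials, as an algebra homomorphism in `q`. -/
noncomputable def shiftedOp {n : ℕ} (a : Fin n → ℂ) :
    MvPolynomial (Fin n) ℂ →ₐ[ℂ] Module.End ℂ (MvPolynomial (Fin n) ℂ) :=
  haveI : IsMulCommutative (Algebra.adjoin ℂ (Set.range (shiftedPderiv a))) :=
    Algebra.isMulCommutative_adjoin ℂ (by
      rintro _ ⟨i, rfl⟩ _ ⟨j, rfl⟩
      exact shiftedPderiv_commute a i j)
  letI : CommSemiring (Algebra.adjoin ℂ (Set.range (shiftedPderiv a))) :=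
    IsMulCommutative.instCommSemiring
  (Algebra.adjoin ℂ (Set.range (shiftedPderiv a))).val.comp
    (aeval fun i => ⟨shiftedPderiv a i, Algebra.subset_adjoin ⟨i, rfl⟩⟩)

@[simp]
theorem shiftedOp_X {n : ℕ} (a : Fin n → ℂ) (i : Fin n) :
    shiftedOp a (X i) = shiftedPderiv a i := by
  simp [shiftedOp]

@[simp]
theorem shiftedOp_C {n : ℕ} (a : Fin n → ℂ) (c : ℂ) (P : MvPolynomial (Fin n) ℂ) :
    shiftedOp a (C c) P = c • P := by
  rw [← algebraMap_eq, AlgHom.commutes, Module.algebraMap_end_apply]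

theorem shiftedOp_monomial {n : ℕ} (a : Fin n → ℂ) (α : Fin n →₀ ℕ) (c : ℂ) :
    shiftedOp a (monomial α c) =
      c • ((List.finRange n).map fun i => shiftedPderiv a i ^ α i).prod := by
  have h : monomial α c =
      c • ((List.finRange n).map fun i => (X i : MvPolynomial _ ℂ) ^ α i).prod := by
    rw [monomial_eq, ← C_mul', Finsupp.prod_fintype _ _ (by simp), ← List.prod_ofFn, List.ofFn_eq_map]
  rw [h, map_smul, map_list_prod, List.map_map]
  congr 3
  funext i
  simp

/-- The commutator of `p(∂ + a)` with multiplication by `Xᵢ` is `(∂ᵢ p)(∂ + a)`. -/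
theorem shiftedOp_X_mul {n : ℕ} (a : Fin n → ℂ) (p : MvPolynomial (Fin n) ℂ) (i : Fin n)
    (q : MvPolynomial (Fin n) ℂ) :
    shiftedOp a p (X i * q) = X i * shiftedOp a p q + shiftedOp a (pderiv i p) q := by
  induction p using MvPolynomial.induction_on generalizing q with
  | C c => simp
  | add p₁ p₂ h₁ h₂ =>
    simp only [map_add, LinearMap.add_apply, h₁, h₂]
    ring
  | mul_X p j h =>
    have hj : shiftedPderiv a j (X i * q) =
        X i * shiftedPderiv a j q + (Pi.single i 1 : Fin n → MvPolynomial (Fin n) ℂ) j * q := by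
      simp only [shiftedPderiv_apply, Derivation.leibniz, pderiv_X, smul_eq_mul, Pi.single_comm,
        Pi.single_apply, smul_eq_C_mul]
      ring
    have hs : shiftedOp a p ((Pi.single i 1 : Fin n → MvPolynomial (Fin n) ℂ) j * q) =
        shiftedOp a (p * (Pi.single i 1 : Fin n → MvPolynomial (Fin n) ℂ) j) q := by
      by_cases hij : j = i
      · subst hij; simp
      · simp [hij]
    have hp : pderiv i (p * X j) =
        pderiv i p * X j + p * (Pi.single i 1 : Fin n → MvPolynomial (Fin n) ℂ) j := by
      simp only [Derivation.leibniz, pderiv_X, smul_eq_mul]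
      ring
    rw [hp, map_add, LinearMap.add_apply, ← hs]
    simp only [map_mul, Module.End.mul_apply, shiftedOp_X, hj, map_add, h]
    ring

theorem shiftedOp_apply_C {n : ℕ} (a : Fin n → ℂ) (p : MvPolynomial (Fin n) ℂ) (c : ℂ) :
    shiftedOp a p (C c) = C (c * eval a p) := by
  induction p using MvPolynomial.induction_on generalizing c with
  | C d => simp [smul_eq_C_mul, mul_comm]
  | add p₁ p₂ h₁ h₂ => simp [h₁, h₂, mul_add]
  | mul_X p j h =>
    have : shiftedPderiv a j (C c) = C (c * a j) := by
      simp [shiftedPderiv_apply, smul_eq_C_mul, mul_comm]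
    rw [map_mul, Module.End.mul_apply, shiftedOp_X, this, h, map_mul (eval a), eval_X]
    congr 1
    ring

theorem eval_shiftedOp_comm {n : ℕ} (a b : Fin n → ℂ) (p q : MvPolynomial (Fin n) ℂ) :
    eval b (shiftedOp a q p) = eval a (shiftedOp b p q) := by
  induction q using MvPolynomial.induction_on generalizing p with
  | C c => simp [shiftedOp_apply_C, smul_eq_C_mul]
  | add q₁ q₂ h₁ h₂ => simp [h₁, h₂]
  | mul_X q i h =>
    rw [map_mul, Module.End.mul_apply, shiftedOp_X, shiftedPderiv_apply, map_add, map_smul,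
      map_add, smul_eval, h, h, mul_comm q, shiftedOp_X_mul, map_add, map_mul, eval_X, add_comm]

/-- The function `w ↦ P(w) exp (a ⬝ w)`. -/
noncomputable def polyExp {n : ℕ} (a : Fin n → ℂ) (P : MvPolynomial (Fin n) ℂ) :
    (Fin n → ℝ) → ℂ :=
  fun w => eval (fun i => (w i : ℂ)) P * Complex.exp (∑ i, a i * (w i : ℂ))

theorem hasFDerivAt_ofReal_apply_s9 {n : ℕ} (i : Fin n) (w : Fin n → ℝ) :
    HasFDerivAt (fun w : Fin n → ℝ => (w i : ℂ))
      (Complex.ofRealCLM.comp (ContinuousLinearMap.proj i)) w :=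
  (Complex.ofRealCLM.comp
    (ContinuousLinearMap.proj (R := ℝ) (φ := fun _ : Fin n => ℝ) i)).hasFDerivAt

theorem hasFDerivAt_eval_ofReal {n : ℕ} (P : MvPolynomial (Fin n) ℂ) (w : Fin n → ℝ) :
    HasFDerivAt (fun w : Fin n → ℝ => eval (fun i => (w i : ℂ)) P)
      (∑ i, eval (fun i => (w i : ℂ)) (pderiv i P) •
        Complex.ofRealCLM.comp
          (ContinuousLinearMap.proj (R := ℝ) (φ := fun _ : Fin n => ℝ) i)) w := by
  induction P using MvPolynomial.induction_on with
  | C c =>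
    simp only [eval_C]
    refine (hasFDerivAt_const c w).congr_fderiv (ContinuousLinearMap.ext fun v => ?_)
    simp
  | add p q hp hq =>
    simp only [map_add]
    refine (hp.fun_add hq).congr_fderiv (ContinuousLinearMap.ext fun v => ?_)
    simp [add_mul, Finset.sum_add_distrib]
  | mul_X p j hp =>
    simp only [map_mul, eval_X]
    refine (hp.fun_mul (hasFDerivAt_ofReal_apply_s9 j w)).congr_fderiv
      (ContinuousLinearMap.ext fun v => ?_)
    simp [pderiv_X, add_mul, Finset.sum_add_distrib, Finset.mul_sum, mul_assoc, Pi.single_apply,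
      apply_ite]

theorem pdF_polyExp {n : ℕ} (a : Fin n → ℂ) (i : Fin n) (P : MvPolynomial (Fin n) ℂ) :
    pdF i (polyExp a P) = polyExp a (shiftedPderiv a i P) := by
  funext w
  have hs : HasFDerivAt (fun w : Fin n → ℝ => ∑ i, a i * (w i : ℂ))
      (∑ i, a i • Complex.ofRealCLM.comp
        (ContinuousLinearMap.proj (R := ℝ) (φ := fun _ : Fin n => ℝ) i)) w :=
    HasFDerivAt.fun_sum fun i _ => (hasFDerivAt_ofReal_apply_s9 i w).const_mul (a i)
  have h := (hasFDerivAt_eval_ofReal P w).mul hs.cexp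
  have h' : fderiv ℝ (polyExp a P) w = _ := h.fderiv
  rw [pdF, h']
  simp [polyExp, shiftedPderiv_apply, Pi.single_apply, apply_ite, smul_eval]
  ring

theorem pdF_iterate_polyExp {n : ℕ} (a : Fin n → ℂ) (i : Fin n) (k : ℕ)
    (P : MvPolynomial (Fin n) ℂ) :
    (pdF i)^[k] (polyExp a P) = polyExp a ((shiftedPderiv a i ^ k) P) := by
  induction k with
  | zero => rfl
  | succ k ih => rw [Function.iterate_succ_apply', ih, pdF_polyExp, pow_succ', Module.End.mul_apply]

theorem ipdF_polyExp {n : ℕ} (a : Fin n → ℂ) (α : Fin n → ℕ) (P : MvPolynomial (Fin n) ℂ) :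
    ipdF α (polyExp a P) =
      polyExp a (((List.finRange n).map fun i => shiftedPderiv a i ^ α i).prod P) := by
  rw [ipdF, List.ofFn_eq_map]
  induction List.finRange n with
  | nil => rfl
  | cons i l ih =>
    simp only [List.map_cons, List.foldr_cons, Function.comp_apply, List.prod_cons,
      Module.End.mul_apply, ih, pdF_iterate_polyExp]

theorem PDop_polyExp {n : ℕ} (a : Fin n → ℂ) (q P : MvPolynomial (Fin n) ℂ) :
    PDop q (polyExp a P) = polyExp a (shiftedOp a q P) := by
  have h : shiftedOp a q P = ∑ α ∈ q.support,
      q.coeff α • ((List.finRange n).map fun i => shiftedPderiv a i ^ α i).prod P := by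
    conv_lhs => rw [q.as_sum]
    simp only [map_sum, shiftedOp_monomial, LinearMap.sum_apply, LinearMap.smul_apply]
  funext w
  simp [h, PDop, ipdF_polyExp, polyExp, Finset.sum_mul, mul_assoc, smul_eval]

/-- `q(∂_z)•(p(z)·exp(xᵀz)) = p(∂_x)•(q(x)·exp(xᵀz))` as functions of
`(x,z) ∈ ℝⁿ × ℝⁿ` (derivatives taken in the indicated group of variables). -/
theorem stmt9 {n : ℕ} (p q : MvPolynomial (Fin n) ℂ) (x z : Fin n → ℝ) :
    PDop q (fun w => MvPolynomial.eval (fun i => (w i : ℂ)) p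
      * Complex.exp (∑ i, (x i : ℂ) * (w i : ℂ))) z
    = PDop p (fun v => MvPolynomial.eval (fun i => (v i : ℂ)) q
      * Complex.exp (∑ i, (v i : ℂ) * (z i : ℂ))) x := by
  have hx : (fun v : Fin n → ℝ => eval (fun i => (v i : ℂ)) q
      * Complex.exp (∑ i, (v i : ℂ) * (z i : ℂ))) = polyExp (fun i => (z i : ℂ)) q := by
    funext v
    simp only [polyExp, mul_comm (v _ : ℂ)]
  change PDop q (polyExp (fun i => (x i : ℂ)) p) z = _
  rw [hx, PDop_polyExp, PDop_polyExp]
  simp only [polyExp, eval_shiftedOp_comm _ _ p q, mul_comm]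
end

section
/- Let K be a field of characteristic zero, let c, k, ν be positive integers, let S = K[y₁,…,y_c], and let m = ⟨y₁,…,y_c⟩. Then the assignment sending a submodule L ⊆ S^k to its space of polynomial solutions Sol(L) = { q ∈ K[y₁,…,y_c]^k : ∑_{j=1}^k f_j(∂)•q_j = 0 for all f = (f₁,…,f_k) ∈ L } is a bijection from the set of submodules L ⊆ S^k satisfying dim_K(S^k/L) = ν and m^N·S^k ⊆ L for some N ∈ ℕ, onto the set of ν-dimensional K-linear subspaces of K[y₁,…,y_c]^k that are closed under each formal partial derivative ∂/∂y_i applied coordinatewise. -/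
open MvPolynomial

namespace MvPolynomial

variable {K : Type} [Field K] {n : ℕ}

/-- The multi-index factorial `α!`, as an element of `K`. -/
noncomputable def multiFactorial (K : Type) [Field K] (α : Fin n →₀ ℕ) : K :=
  ∏ i, ((α i).factorial : K)

theorem multiFactorial_ne_zero [CharZero K] (α : Fin n →₀ ℕ) : multiFactorial K α ≠ 0 :=
  Finset.prod_ne_zero_iff.mpr fun i _ => Nat.cast_ne_zero.mpr (α i).factorial_ne_zero

theorem multiFactorial_add_single (α : Fin n →₀ ℕ) (i : Fin n) :
    multiFactorial K (α + Finsupp.single i 1) = (α i + 1) * multiFactorial K α := by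
  unfold multiFactorial
  rw [← Finset.mul_prod_erase _ _ (Finset.mem_univ i),
    ← Finset.mul_prod_erase Finset.univ (fun j => ((α j).factorial : K)) (Finset.mem_univ i),
    ← mul_assoc]
  congr 1
  · simp [Nat.factorial_succ]
  · refine Finset.prod_congr rfl fun j hj => ?_
    simp [Finsupp.single_eq_of_ne (Finset.ne_of_mem_erase hj)]

theorem multiFactorial_mul_coeff_pderiv (i : Fin n) (q : MvPolynomial (Fin n) K)
    (β : Fin n →₀ ℕ) :
    multiFactorial K β * coeff β (pderiv i q) =
      multiFactorial K (β + Finsupp.single i 1) * coeff (β + Finsupp.single i 1) q := by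
  rw [coeff_pderiv, multiFactorial_add_single]
  ring

theorem multiFactorial_mul_coeff_iterate_pderiv (i : Fin n) (m : ℕ)
    (q : MvPolynomial (Fin n) K) (β : Fin n →₀ ℕ) :
    multiFactorial K β * coeff β ((fun g => pderiv i g)^[m] q) =
      multiFactorial K (β + Finsupp.single i m) * coeff (β + Finsupp.single i m) q := by
  induction m generalizing β with
  | zero => simp
  | succ m ih =>
    rw [Function.iterate_succ_apply', multiFactorial_mul_coeff_pderiv, ih, add_assoc,
      ← Finsupp.single_add, add_comm 1 m]

theorem multiFactorial_mul_coeff_foldr_pderiv (α : Fin n → ℕ) (l : List (Fin n))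
    (q : MvPolynomial (Fin n) K) (β : Fin n →₀ ℕ) :
    multiFactorial K β *
        coeff β (((l.map fun i => (fun g => pderiv i g)^[α i]).foldr (· ∘ ·) id) q) =
      multiFactorial K (β + (l.map fun i => Finsupp.single i (α i)).sum) *
        coeff (β + (l.map fun i => Finsupp.single i (α i)).sum) q := by
  induction l generalizing β with
  | nil => simp
  | cons i l ih =>
    rw [List.map_cons, List.foldr_cons, Function.comp_apply,
      multiFactorial_mul_coeff_iterate_pderiv, ih, List.map_cons, List.sum_cons, add_assoc]

theorem multiFactorial_mul_coeff_ipdP (α β : Fin n →₀ ℕ) (q : MvPolynomial (Fin n) K) :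
    multiFactorial K β * coeff β (ipdP (fun i => α i) q) =
      multiFactorial K (β + α) * coeff (β + α) q := by
  have hα : ((List.finRange n).map fun i => Finsupp.single i (α i)).sum = α := by
    rw [← List.ofFn_eq_map, List.sum_ofFn, Finsupp.univ_sum_single]
  have h := multiFactorial_mul_coeff_foldr_pderiv (fun i => α i) (List.finRange n) q β
  rw [hα] at h
  rw [ipdP, List.ofFn_eq_map]
  exact h

/-- The apolarity pairing `⟨q, f⟩ = (f(∂) • q)(0) = ∑ α, α! * q_α * f_α`. -/
noncomputable def apolarPairing :
    MvPolynomial (Fin n) K →ₗ[K] MvPolynomial (Fin n) K →ₗ[K] K :=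
  ((basisMonomials (Fin n) K).constr K).toLinearMap ∘ₗ
    LinearMap.pi fun α => multiFactorial K α • lcoeff K α

theorem apolarPairing_monomial (q : MvPolynomial (Fin n) K) (α : Fin n →₀ ℕ) (a : K) :
    apolarPairing q (monomial α a) = a * (multiFactorial K α * coeff α q) := by
  have h : monomial α a = a • basisMonomials (Fin n) K α := by
    simp [coe_basisMonomials, smul_monomial]
  rw [h, map_smul, apolarPairing, LinearMap.comp_apply, LinearEquiv.coe_coe,
    Module.Basis.constr_basis]
  simp

theorem apolarPairing_eq_sum (q f : MvPolynomial (Fin n) K) :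
    apolarPairing q f =
      ∑ α ∈ f.support, coeff α f * (multiFactorial K α * coeff α q) := by
  conv_lhs => rw [f.as_sum, map_sum]
  simp only [apolarPairing_monomial]

theorem apolarPairing_injective [CharZero K] :
    Function.Injective (apolarPairing (K := K) (n := n)) := by
  intro p q h
  ext α
  have hα := congrArg (fun φ => φ (monomial α 1)) h
  simpa [apolarPairing_monomial, multiFactorial_ne_zero] using hα

theorem apolarPairing_pderiv (i : Fin n) (q g : MvPolynomial (Fin n) K) :
    apolarPairing (pderiv i q) g = apolarPairing q (X i * g) := by
  induction g using MvPolynomial.induction_on' with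
  | monomial β b =>
    rw [X, monomial_mul, one_mul, apolarPairing_monomial, apolarPairing_monomial,
      multiFactorial_mul_coeff_pderiv, add_comm]
  | add p r hp hr => rw [mul_add, map_add, map_add, hp, hr]

theorem apolarPairing_PDopP (f q g : MvPolynomial (Fin n) K) :
    apolarPairing (PDopP f q) g = apolarPairing q (g * f) := by
  induction g using MvPolynomial.induction_on' with
  | monomial β b =>
    conv_rhs => rw [f.as_sum]
    rw [apolarPairing_monomial, PDopP, coeff_sum, Finset.mul_sum, Finset.mul_sum,
      Finset.mul_sum, map_sum]
    refine Finset.sum_congr rfl fun α _ => ?_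
    rw [monomial_mul, apolarPairing_monomial, ← multiFactorial_mul_coeff_ipdP, coeff_smul,
      smul_eq_mul]
    ring
  | add p r hp hr => rw [add_mul, map_add, map_add, hp, hr]

theorem apolarPairing_eq_zero_of_mem_pow {N : ℕ} {q f : MvPolynomial (Fin n) K}
    (hq : q.totalDegree < N) (hf : f ∈ idealOfVars (Fin n) K ^ N) :
    apolarPairing q f = 0 := by
  rw [apolarPairing_eq_sum]
  refine Finset.sum_eq_zero fun α hα => ?_
  have hN := (mem_pow_idealOfVars_iff N f).mp hf α hα
  rw [coeff_eq_zero_of_totalDegree_lt (f := q), mul_zero, mul_zero]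
  exact hq.trans_le hN

theorem exists_apolarPairing_eq [CharZero K] {N : ℕ} (φ : MvPolynomial (Fin n) K →ₗ[K] K)
    (hφ : ∀ f ∈ idealOfVars (Fin n) K ^ N, φ f = 0) : ∃ q, apolarPairing q = φ := by
  classical
  let B : Finset (Fin n →₀ ℕ) := Finset.Iic (Finsupp.equivFunOnFinite.symm fun _ => N)
  refine ⟨∑ α ∈ B, monomial α (φ (monomial α 1) / multiFactorial K α), ?_⟩
  refine (basisMonomials (Fin n) K).ext fun β => ?_
  rw [coe_basisMonomials, apolarPairing_monomial, one_mul, coeff_sum]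
  simp only [coeff_monomial, Finset.sum_ite_eq']
  split_ifs with hβ
  · exact mul_div_cancel₀ _ (multiFactorial_ne_zero β)
  · rw [mul_zero, hφ]
    rw [monomial_mem_pow_idealOfVars_iff _ _ one_ne_zero]
    obtain ⟨i, hi⟩ : ∃ i, N < β i := by
      by_contra! h
      exact hβ (Finset.mem_Iic.mpr fun i => by simpa using h i)
    exact hi.le.trans (Finsupp.le_degree i β)

/-- The apolarity pairing on vectors of polynomials. -/
noncomputable def vecApolarPairing (K : Type) [Field K] (n k : ℕ) :
    (Fin k → MvPolynomial (Fin n) K) →ₗ[K] Module.Dual K (Fin k → MvPolynomial (Fin n) K) :=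
  ∑ j, LinearMap.compl₁₂ apolarPairing (LinearMap.proj j) (LinearMap.proj j)

variable {k : ℕ}

theorem vecApolarPairing_apply (q f : Fin k → MvPolynomial (Fin n) K) :
    vecApolarPairing K n k q f = ∑ j, apolarPairing (q j) (f j) := by
  simp [vecApolarPairing, LinearMap.sum_apply]

theorem vecApolarPairing_single (q : Fin k → MvPolynomial (Fin n) K) (j : Fin k)
    (g : MvPolynomial (Fin n) K) :
    vecApolarPairing K n k q (Pi.single j g) = apolarPairing (q j) g := by
  rw [vecApolarPairing_apply, Finset.sum_eq_single j]
  · simp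
  · intro i _ hi
    simp [hi]
  · simp

theorem vecApolarPairing_injective [CharZero K] :
    Function.Injective (vecApolarPairing K n k) := by
  intro p q h
  funext j
  refine apolarPairing_injective (LinearMap.ext fun g => ?_)
  rw [← vecApolarPairing_single, ← vecApolarPairing_single, h]

theorem vecApolarPairing_pderiv (i : Fin n) (q f : Fin k → MvPolynomial (Fin n) K) :
    vecApolarPairing K n k (fun j => pderiv i (q j)) f =
      vecApolarPairing K n k q ((X i : MvPolynomial (Fin n) K) • f) := by
  simp [vecApolarPairing_apply, apolarPairing_pderiv]

theorem apolarPairing_sum_PDopP (f q : Fin k → MvPolynomial (Fin n) K)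
    (g : MvPolynomial (Fin n) K) :
    apolarPairing (∑ j, PDopP (f j) (q j)) g = vecApolarPairing K n k q (g • f) := by
  simp [vecApolarPairing_apply, apolarPairing_PDopP, LinearMap.sum_apply]

theorem exists_vecApolarPairing_eq [CharZero K] {N : ℕ}
    (φ : Module.Dual K (Fin k → MvPolynomial (Fin n) K))
    (hφ : ∀ f ∈ idealOfVars (Fin n) K ^ N •
      (⊤ : Submodule (MvPolynomial (Fin n) K) (Fin k → MvPolynomial (Fin n) K)), φ f = 0) :
    ∃ q, vecApolarPairing K n k q = φ := by
  have h (j : Fin k) : ∃ q, apolarPairing q =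
      φ ∘ₗ LinearMap.single K (fun _ => MvPolynomial (Fin n) K) j := by
    refine exists_apolarPairing_eq (N := N) _ fun f hf => hφ _ ?_
    have := Submodule.smul_mem_smul hf
      (Submodule.mem_top (R := MvPolynomial (Fin n) K)
        (x := (Pi.single j 1 : Fin k → MvPolynomial (Fin n) K)))
    rwa [← Pi.single_smul, smul_eq_mul, mul_one] at this
  choose q hq using h
  refine ⟨q, LinearMap.pi_ext fun j g => ?_⟩
  rw [vecApolarPairing_single, hq]
  rfl

theorem vecApolarPairing_eq_zero_of_mem_pow_smul {N : ℕ}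
    {q f : Fin k → MvPolynomial (Fin n) K} (hq : ∀ j, (q j).totalDegree < N)
    (hf : f ∈ idealOfVars (Fin n) K ^ N •
      (⊤ : Submodule (MvPolynomial (Fin n) K) (Fin k → MvPolynomial (Fin n) K))) :
    vecApolarPairing K n k q f = 0 := by
  rw [vecApolarPairing_apply]
  refine Finset.sum_eq_zero fun j _ => apolarPairing_eq_zero_of_mem_pow (hq j) ?_
  induction hf using Submodule.smul_induction_on' with
  | smul r hr m _ => exact Ideal.mul_mem_right _ _ hr
  | add x _ y _ hx hy => exact Ideal.add_mem _ hx hy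

/-- The polynomial solutions of `L`, as a `K`-subspace. -/
noncomputable def solutionSpace
    (L : Submodule (MvPolynomial (Fin n) K) (Fin k → MvPolynomial (Fin n) K)) :
    Submodule K (Fin k → MvPolynomial (Fin n) K) :=
  (L.restrictScalars K).dualAnnihilator.comap (vecApolarPairing K n k)

theorem mem_solutionSpace [CharZero K]
    {L : Submodule (MvPolynomial (Fin n) K) (Fin k → MvPolynomial (Fin n) K)}
    {q : Fin k → MvPolynomial (Fin n) K} :
    q ∈ solutionSpace L ↔ ∀ f ∈ L, ∑ j, PDopP (f j) (q j) = 0 := by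
  rw [solutionSpace, Submodule.mem_comap, Submodule.mem_dualAnnihilator]
  constructor
  · intro h f hf
    refine apolarPairing_injective (LinearMap.ext fun g => ?_)
    rw [apolarPairing_sum_PDopP, h _ (L.smul_mem g hf), map_zero, LinearMap.zero_apply]
  · intro h f hf
    rw [← one_smul (MvPolynomial (Fin n) K) f, ← apolarPairing_sum_PDopP, h f hf, map_zero,
      LinearMap.zero_apply]

theorem pderiv_mem_solutionSpace
    {L : Submodule (MvPolynomial (Fin n) K) (Fin k → MvPolynomial (Fin n) K)}
    {q : Fin k → MvPolynomial (Fin n) K} (hq : q ∈ solutionSpace L) (i : Fin n) :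
    (fun j => pderiv i (q j)) ∈ solutionSpace L := by
  rw [solutionSpace, Submodule.mem_comap, Submodule.mem_dualAnnihilator] at hq ⊢
  intro f hf
  rw [vecApolarPairing_pderiv]
  exact hq _ (L.smul_mem _ hf)

theorem map_solutionSpace [CharZero K]
    {L : Submodule (MvPolynomial (Fin n) K) (Fin k → MvPolynomial (Fin n) K)} {N : ℕ}
    (hN : idealOfVars (Fin n) K ^ N • ⊤ ≤ L) :
    (solutionSpace L).map (vecApolarPairing K n k) = (L.restrictScalars K).dualAnnihilator := by
  rw [solutionSpace, Submodule.map_comap_eq, inf_eq_right]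
  intro φ hφ
  rw [Submodule.mem_dualAnnihilator] at hφ
  exact exists_vecApolarPairing_eq φ fun f hf => hφ f (hN hf)

/-- The submodule of `S^k` annihilated by a `∂`-stable space of polynomial vectors. -/
noncomputable def annihilatingSubmodule
    (W : Submodule K (Fin k → MvPolynomial (Fin n) K))
    (hW : ∀ q ∈ W, ∀ i, (fun j => pderiv i (q j)) ∈ W) :
    Submodule (MvPolynomial (Fin n) K) (Fin k → MvPolynomial (Fin n) K) where
  __ := (W.map (vecApolarPairing K n k)).dualCoannihilator
  smul_mem' g f hf := by
    change g • f ∈ (W.map (vecApolarPairing K n k)).dualCoannihilator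
    replace hf : f ∈ (W.map (vecApolarPairing K n k)).dualCoannihilator := hf
    induction g using MvPolynomial.induction_on generalizing f with
    | C a =>
      rw [← algebraMap_eq, algebraMap_smul]
      exact Submodule.smul_mem _ a hf
    | add p r hp hr =>
      rw [add_smul]
      exact Submodule.add_mem _ (hp f hf) (hr f hf)
    | mul_X p i hp =>
      rw [mul_smul]
      refine hp _ ?_
      rw [Submodule.mem_dualCoannihilator] at hf ⊢
      rintro _ ⟨q, hq, rfl⟩
      rw [← vecApolarPairing_pderiv]
      exact hf _ ⟨_, hW q hq i, rfl⟩

theorem restrictScalars_annihilatingSubmodule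
    (W : Submodule K (Fin k → MvPolynomial (Fin n) K))
    (hW : ∀ q ∈ W, ∀ i, (fun j => pderiv i (q j)) ∈ W) :
    (annihilatingSubmodule W hW).restrictScalars K =
      (W.map (vecApolarPairing K n k)).dualCoannihilator := rfl

theorem solutionSpace_annihilatingSubmodule [CharZero K]
    (W : Submodule K (Fin k → MvPolynomial (Fin n) K)) [FiniteDimensional K W]
    (hW : ∀ q ∈ W, ∀ i, (fun j => pderiv i (q j)) ∈ W) :
    solutionSpace (annihilatingSubmodule W hW) = W := by
  rw [solutionSpace, restrictScalars_annihilatingSubmodule,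
    Subspace.dualCoannihilator_dualAnnihilator_eq,
    Submodule.comap_map_eq_of_injective vecApolarPairing_injective]

theorem exists_pow_smul_le_annihilatingSubmodule
    (W : Submodule K (Fin k → MvPolynomial (Fin n) K)) [FiniteDimensional K W]
    (hW : ∀ q ∈ W, ∀ i, (fun j => pderiv i (q j)) ∈ W) :
    ∃ N : ℕ, idealOfVars (Fin n) K ^ N • ⊤ ≤ annihilatingSubmodule W hW := by
  obtain ⟨s, hs⟩ := (Submodule.fg_iff_finiteDimensional W).mpr inferInstance
  let N := (s.sup fun q => Finset.univ.sup fun j => (q j).totalDegree) + 1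
  refine ⟨N, fun f hf => ?_⟩
  change f ∈ (W.map (vecApolarPairing K n k)).dualCoannihilator
  rw [Submodule.mem_dualCoannihilator]
  rintro _ ⟨q, hq, rfl⟩
  replace hq : q ∈ Submodule.span K (s : Set (Fin k → MvPolynomial (Fin n) K)) := hs ▸ hq
  induction hq using Submodule.span_induction with
  | mem q hq =>
    refine vecApolarPairing_eq_zero_of_mem_pow_smul (fun j => Nat.lt_succ_of_le ?_) hf
    exact (Finset.le_sup (f := fun j => (q j).totalDegree) (Finset.mem_univ j)).trans
      (Finset.le_sup (f := fun q : Fin k → MvPolynomial (Fin n) K =>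
        Finset.univ.sup fun j => (q j).totalDegree) hq)
  | zero => simp
  | add p q _ _ hp hq => rw [map_add, LinearMap.add_apply, hp, hq, add_zero]
  | smul a q _ hq => rw [map_smul, LinearMap.smul_apply, hq, smul_zero]

/-- `Sol(L)` is isomorphic to the dual of `S^k / L` when `m^N S^k ⊆ L`. -/
noncomputable def solutionSpaceEquivDual [CharZero K]
    {L : Submodule (MvPolynomial (Fin n) K) (Fin k → MvPolynomial (Fin n) K)} {N : ℕ}
    (hN : idealOfVars (Fin n) K ^ N • ⊤ ≤ L) :
    solutionSpace L ≃ₗ[K] Module.Dual K ((Fin k → MvPolynomial (Fin n) K) ⧸ L) :=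
  (Submodule.equivMapOfInjective _ vecApolarPairing_injective _).trans <|
    (LinearEquiv.ofEq _ _ (map_solutionSpace hN)).trans <|
      (L.restrictScalars K).dualQuotEquivDualAnnihilator.symm.trans
        (Submodule.Quotient.restrictScalarsEquiv K L).symm.dualMap

theorem finrank_solutionSpace [CharZero K]
    {L : Submodule (MvPolynomial (Fin n) K) (Fin k → MvPolynomial (Fin n) K)} {N : ℕ}
    (hN : idealOfVars (Fin n) K ^ N • ⊤ ≤ L) :
    Module.finrank K (solutionSpace L) =
      Module.finrank K ((Fin k → MvPolynomial (Fin n) K) ⧸ L) :=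
  (solutionSpaceEquivDual hN).finrank_eq.trans Subspace.dual_finrank_eq

theorem solutionSpace_injOn [CharZero K] :
    Set.InjOn (solutionSpace (K := K) (n := n) (k := k))
      {L | ∃ N : ℕ, idealOfVars (Fin n) K ^ N • ⊤ ≤ L} := by
  rintro L ⟨N, hN⟩ L' ⟨N', hN'⟩ h
  refine Submodule.restrictScalars_injective K _ _ (Subspace.dualAnnihilator_inj.mp ?_)
  rw [← map_solutionSpace hN, ← map_solutionSpace hN', h]

end MvPolynomial

/-- over a field `K` of characteristic zero, `L ↦ Sol(L)` is a bijection
from the set of submodules `L ⊆ S^k` (`S = K[y₁,…,y_c]`) with `dim_K(S^k/L) = ν` that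
contain `m^N·S^k` for some `N` (`m = ⟨y₁,…,y_c⟩`), onto the set of `ν`-dimensional
`K`-linear subspaces of `K[y₁,…,y_c]^k` closed under each formal partial derivative
applied coordinatewise. -/
theorem stmt14 {K : Type} [Field K] [CharZero K] {c k : ℕ} (ν : ℕ)
    (hc : 0 < c) (hk : 0 < k) (hν : 0 < ν) :
    Set.BijOn
      (fun L : Submodule (MvPolynomial (Fin c) K) (Fin k → MvPolynomial (Fin c) K) =>
        {q : Fin k → MvPolynomial (Fin c) K | ∀ f ∈ L, (∑ j, PDopP (f j) (q j)) = 0})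
      {L : Submodule (MvPolynomial (Fin c) K) (Fin k → MvPolynomial (Fin c) K) |
        Module.finrank K ((Fin k → MvPolynomial (Fin c) K) ⧸ L) = ν ∧
        ∃ N : ℕ, (Ideal.span (Set.range (X : Fin c → MvPolynomial (Fin c) K))) ^ N •
          (⊤ : Submodule (MvPolynomial (Fin c) K) (Fin k → MvPolynomial (Fin c) K)) ≤ L}
      {V : Set (Fin k → MvPolynomial (Fin c) K) |
        ∃ W : Submodule K (Fin k → MvPolynomial (Fin c) K),
          (W : Set (Fin k → MvPolynomial (Fin c) K)) = V ∧
          FiniteDimensional K W ∧ Module.finrank K W = ν ∧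
          ∀ q ∈ V, ∀ i : Fin c, (fun j => MvPolynomial.pderiv i (q j)) ∈ V} := by
  have hsol (L : Submodule (MvPolynomial (Fin c) K) (Fin k → MvPolynomial (Fin c) K)) :
      {q : Fin k → MvPolynomial (Fin c) K | ∀ f ∈ L, (∑ j, PDopP (f j) (q j)) = 0} =
        (solutionSpace L : Set (Fin k → MvPolynomial (Fin c) K)) :=
    Set.ext fun q => mem_solutionSpace.symm
  simp only [hsol]
  refine ⟨?_, ?_, ?_⟩
  · rintro L ⟨hL, N, hN⟩
    have hdim := (finrank_solutionSpace hN).trans hL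
    exact ⟨solutionSpace L, rfl, FiniteDimensional.of_finrank_pos (hdim ▸ hν), hdim,
      fun q hq i => pderiv_mem_solutionSpace hq i⟩
  · rintro L ⟨-, hL⟩ L' ⟨-, hL'⟩ h
    exact solutionSpace_injOn hL hL' (SetLike.coe_injective h)
  · rintro _ ⟨W, rfl, hfin, hdim, hW⟩
    obtain ⟨N, hN⟩ := exists_pow_smul_le_annihilatingSubmodule W hW
    have hsolW := solutionSpace_annihilatingSubmodule W hW
    refine ⟨annihilatingSubmodule W hW, ⟨?_, N, hN⟩, congrArg _ hsolW⟩
    rw [← finrank_solutionSpace hN, hsolW, hdim]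
end
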